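/- Let (x*, y*, w*) be a KKT point and let (x^{k+1}, y^{k+1}, w^{k+1}) be obtained from (y^k, w^k) by one LP-ADMM step. Define m(w, y) = (1/(2ρ))‖w − w*‖² + (ρ/2)‖y − y*‖² − B_f(y*, y). Then 0 ≤ m(w^k, y^k) − m(w^{k+1}, y^{k+1}) + (L_f/2)‖y^{k+1} − y^k‖² − (ρ/2)‖Ax^{k+1} − y^k‖². -/

import Mathlib

open scoped RealInnerProductSpace

/-- If a quadratic without constant term is nonnegative on `(0,1]`, its slope is nonnegative. -/
lemma aux_limit {c d : ℝ} (h : ∀ t : ℝ, 0 < t → t ≤ 1 → 0 ≤ t * c + t ^ 2 * d) : 0 ≤ c := by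
  by_contra! hc
  have hd : 0 < |d| + 1 := by positivity
  have hcd : 0 < -c / (2 * (|d| + 1)) := by apply div_pos <;> linarith
  have ht : 0 < min 1 (-c / (2 * (|d| + 1))) := lt_min one_pos hcd
  have h1 := h _ ht (min_le_left _ _)
  have h2 : min 1 (-c / (2 * (|d| + 1))) ≤ -c / (2 * (|d| + 1)) := min_le_right _ _
  set t := min 1 (-c / (2 * (|d| + 1)))
  rw [le_div_iff₀ (by positivity)] at h2
  have h3 : 0 ≤ t * (c + t * d) := by nlinarith
  have h4 : 0 ≤ c + t * d := nonneg_of_mul_nonneg_right h3 ht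
  have h5 : t * d ≤ t * |d| := mul_le_mul_of_nonneg_left (le_abs_self d) ht.le
  nlinarith

lemma aux_line {E : Type*} [NormedAddCommGroup E] [InnerProductSpace ℝ E] [CompleteSpace E]
    {f : E → ℝ} {f' : E → E} (hgrad : ∀ z, HasGradientAt f (f' z) z) (y v : E) (t : ℝ) :
    HasDerivAt (fun s : ℝ => f (y + s • v)) ⟪f' (y + t • v), v⟫ t := by
  have h1 := (hgrad (y + t • v)).hasFDerivAt
  have h2 : HasDerivAt (fun s : ℝ => y + s • v) v t := by
    simpa using ((hasDerivAt_id t).smul_const v).const_add y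
  have h3 := h1.comp_hasDerivAt t h2
  rw [InnerProductSpace.toDual_apply_apply] at h3
  exact h3

lemma aux_descent {E : Type*} [NormedAddCommGroup E] [InnerProductSpace ℝ E] [CompleteSpace E]
    {f : E → ℝ} {f' : E → E} (hgrad : ∀ z, HasGradientAt f (f' z) z) {L : ℝ}
    (hlip : ∀ a b, ‖f' a - f' b‖ ≤ L * ‖a - b‖) (y v : E) :
    f (y + v) ≤ f y + ⟪f' y, v⟫ + L / 2 * ‖v‖ ^ 2 := by
  have hd : ∀ t : ℝ, HasDerivAt
      (fun s : ℝ => f (y + s • v) - s * ⟪f' y, v⟫ - s ^ 2 * (L / 2 * ‖v‖ ^ 2))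
      (⟪f' (y + t • v), v⟫ - ⟪f' y, v⟫ - 2 * t * (L / 2 * ‖v‖ ^ 2)) t := by
    intro t
    have h1 := aux_line hgrad y v t
    have h2 : HasDerivAt (fun s : ℝ => s * ⟪f' y, v⟫) ⟪f' y, v⟫ t := by
      simpa using (hasDerivAt_id t).mul_const ⟪f' y, v⟫
    have h3 : HasDerivAt (fun s : ℝ => s ^ 2 * (L / 2 * ‖v‖ ^ 2))
        (2 * t * (L / 2 * ‖v‖ ^ 2)) t := by
      simpa using (hasDerivAt_pow 2 t).mul_const (L / 2 * ‖v‖ ^ 2)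
    exact (h1.sub h2).sub h3
  have hanti := antitoneOn_of_deriv_nonpos (convex_Icc (0:ℝ) 1)
    (fun t _ => (hd t).continuousAt.continuousWithinAt)
    (fun t _ => (hd t).differentiableAt.differentiableWithinAt) (by
      intro t ht
      rw [interior_Icc] at ht
      rw [(hd t).deriv, ← inner_sub_left]
      have h1 := real_inner_le_norm (f' (y + t • v) - f' y) v
      have h2 := hlip (y + t • v) y
      rw [add_sub_cancel_left, norm_smul, Real.norm_of_nonneg ht.1.le] at h2
      have h3 := mul_le_mul_of_nonneg_right h2 (norm_nonneg v)
      nlinarith)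
  have h := hanti (Set.left_mem_Icc.2 zero_le_one) (Set.right_mem_Icc.2 zero_le_one) zero_le_one
  simp at h
  linarith

lemma aux_grad {E : Type*} [NormedAddCommGroup E] [InnerProductSpace ℝ E] [CompleteSpace E]
    {f : E → ℝ} {f' : E → E} (hf : ConvexOn ℝ Set.univ f)
    (hgrad : ∀ z, HasGradientAt f (f' z) z) (y z : E) :
    f y + ⟪f' y, z - y⟫ ≤ f z := by
  have hc : ConvexOn ℝ Set.univ (fun s : ℝ => f (y + s • (z - y))) := by
    have := hf.comp_affineMap (AffineMap.lineMap (k := ℝ) y z)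
    rw [Set.preimage_univ] at this
    have e : (fun s : ℝ => f (y + s • (z - y))) = f ∘ (AffineMap.lineMap (k := ℝ) y z) := by
      funext s
      simp [AffineMap.lineMap_apply, add_comm]
    rw [e]
    exact this
  have h1 := aux_line hgrad y (z - y) 0
  have := hc.le_slope_of_hasDerivAt (Set.mem_univ 0) (Set.mem_univ 1) zero_lt_one h1
  simp [slope_def_field] at this
  linarith

/-- The key one-step inequality in the proof of Proposition 4.1(c): with
`m(w, y) = (1/(2ρ))‖w − w*‖² + (ρ/2)‖y − y*‖² − B_f(y*, y)`, one LP-ADMM step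
from `(y^k, w^k)` satisfies
`0 ≤ m(w^k, y^k) − m(w^{k+1}, y^{k+1}) + (L_f/2)‖y^{k+1} − y^k‖²
   − (ρ/2)‖Ax^{k+1} − y^k‖²`. -/
theorem lpadmm_one_step_lyapunov_inequality
    {n N : ℕ} (hn : 0 < n) (hN : 0 < N)
    (A : EuclideanSpace ℝ (Fin n) →L[ℝ] EuclideanSpace ℝ (Fin N))
    (C : Set (EuclideanSpace ℝ (Fin n)))
    (hCne : C.Nonempty) (hCconv : Convex ℝ C) (hCclosed : IsClosed C)
    (P : EuclideanSpace ℝ (Fin N) → ℝ) (hP : ConvexOn ℝ Set.univ P)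
    (f : EuclideanSpace ℝ (Fin N) → ℝ) (hf : ConvexOn ℝ Set.univ f)
    (f' : EuclideanSpace ℝ (Fin N) → EuclideanSpace ℝ (Fin N))
    (hgrad : ∀ z, HasGradientAt f (f' z) z)
    (Lf : ℝ) (hLf : 0 < Lf)
    (hlip : ∀ a b, ‖f' a - f' b‖ ≤ Lf * ‖a - b‖)
    (ρ : ℝ) (hρ : 0 < ρ)
    (xs : EuclideanSpace ℝ (Fin n)) (ys ws : EuclideanSpace ℝ (Fin N))
    (hxsC : xs ∈ C) (hAxs : A xs = ys)
    (hkkt_x : ∀ xx ∈ C, ⟪ws, A xx - A xs⟫ ≤ 0)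
    (hkkt_y : ∀ z, P ys + ⟪-ws - f' ys, z - ys⟫ ≤ P z)
    (yk wk : EuclideanSpace ℝ (Fin N)) (xk1 : EuclideanSpace ℝ (Fin n))
    (yk1 wk1 : EuclideanSpace ℝ (Fin N))
    (hxk1C : xk1 ∈ C)
    (hxk1 : IsMinOn (fun u => ‖A u - yk - ρ⁻¹ • wk‖ ^ 2) C xk1)
    (hyk1 : IsMinOn
      (fun z => ρ / 2 * ‖z - (A xk1 - ρ⁻¹ • (wk + f' yk))‖ ^ 2 + P z)
      Set.univ yk1)
    (hwk1 : wk1 = wk - ρ • (A xk1 - yk1))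
    (m : EuclideanSpace ℝ (Fin N) → EuclideanSpace ℝ (Fin N) → ℝ)
    (hm : ∀ ww yy, m ww yy = 1 / (2 * ρ) * ‖ww - ws‖ ^ 2 + ρ / 2 * ‖yy - ys‖ ^ 2
      - (f ys - f yy - ⟪f' yy, ys - yy⟫)) :
    0 ≤ m wk yk - m wk1 yk1 + Lf / 2 * ‖yk1 - yk‖ ^ 2
        - ρ / 2 * ‖A xk1 - yk‖ ^ 2 := by
  -- descent and monotonicity
  have hdesc := aux_descent hgrad hlip yk (yk1 - yk)
  rw [add_sub_cancel] at hdesc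
  have hg1 := aux_grad hf hgrad ys yk1
  have hg2 := aux_grad hf hgrad yk1 ys
  -- optimality in x
  have hx : 0 ≤ 2 * ⟪A xk1 - yk - ρ⁻¹ • wk, ys - A xk1⟫ := by
    apply aux_limit (d := ‖ys - A xk1‖ ^ 2)
    intro t ht0 ht1
    have hmem : xk1 + t • (xs - xk1) ∈ C := hCconv.add_smul_sub_mem hxk1C hxsC ⟨ht0.le, ht1⟩
    have h := isMinOn_iff.1 hxk1 _ hmem
    have e : A (xk1 + t • (xs - xk1)) - yk - ρ⁻¹ • wk
        = (A xk1 - yk - ρ⁻¹ • wk) + t • (ys - A xk1) := by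
      rw [map_add, map_smul, map_sub, hAxs]; abel
    rw [e, norm_add_sq_real, norm_smul, inner_smul_right, mul_pow, Real.norm_eq_abs, sq_abs] at h
    linarith
  -- optimality in y
  have hy : 0 ≤ ρ * ⟪yk1 - (A xk1 - ρ⁻¹ • (wk + f' yk)), ys - yk1⟫ + (P ys - P yk1) := by
    apply aux_limit (d := ρ / 2 * ‖ys - yk1‖ ^ 2)
    intro t ht0 ht1
    have h := isMinOn_iff.1 hyk1 (yk1 + t • (ys - yk1)) (Set.mem_univ _)
    have hc := hP.2 (Set.mem_univ yk1) (Set.mem_univ ys) (sub_nonneg.2 ht1) ht0.le (by ring)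
    have e1 : (1 - t) • yk1 + t • ys = yk1 + t • (ys - yk1) := by module
    rw [e1, smul_eq_mul, smul_eq_mul] at hc
    have e : yk1 + t • (ys - yk1) - (A xk1 - ρ⁻¹ • (wk + f' yk))
        = (yk1 - (A xk1 - ρ⁻¹ • (wk + f' yk))) + t • (ys - yk1) := by abel
    rw [e, norm_add_sq_real, norm_smul, inner_smul_right, mul_pow, Real.norm_eq_abs, sq_abs] at h
    linarith
  have hkx := hkkt_x xk1 hxk1C
  have hky := hkkt_y yk1
  rw [hAxs] at hkx
  rw [hm, hm]
  have hx' : 0 ≤ ⟪ρ • (A xk1 - yk) - wk, ys - A xk1⟫ := by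
    have e : ρ • (A xk1 - yk) - wk = ρ • (A xk1 - yk - ρ⁻¹ • wk) := by
      rw [smul_sub ρ (A xk1 - yk), smul_inv_smul₀ hρ.ne']
    rw [e, inner_smul_left]
    simp only [conj_trivial]
    apply mul_nonneg hρ.le; linarith
  have hy' : 0 ≤ ⟪wk1 + f' yk, ys - yk1⟫ + (P ys - P yk1) := by
    have e : wk1 + f' yk = ρ • (yk1 - (A xk1 - ρ⁻¹ • (wk + f' yk))) := by
      rw [smul_sub, smul_sub ρ (A xk1), smul_inv_smul₀ hρ.ne', hwk1, smul_sub]; abel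
    rw [e, inner_smul_left]
    simpa using hy
  have hw : wk - ws = (wk1 - ws) + ρ • (A xk1 - yk1) := by rw [hwk1]; abel
  have hn1 : 1 / (2 * ρ) * ‖wk - ws‖ ^ 2 = 1 / (2 * ρ) * ‖wk1 - ws‖ ^ 2
      + ⟪wk1 - ws, A xk1 - yk1⟫ + ρ / 2 * ‖A xk1 - yk1‖ ^ 2 := by
    rw [hw, norm_add_sq_real, norm_smul, inner_smul_right, mul_pow, Real.norm_eq_abs, sq_abs]
    field_simp
  have hwk : wk = wk1 + ρ • (A xk1 - yk1) := by rw [hwk1]; abel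
  rw [hn1]
  rw [hwk] at hx'
  generalize A xk1 = a at *
  generalize f' yk = g at *
  generalize f' yk1 = g1 at *
  generalize f' ys = gs at *
  clear hn1 hw hwk hwk1 hy hx hyk1 hxk1 hkkt_x hkkt_y hm
  simp only [← real_inner_self_eq_norm_sq, inner_add_left, inner_sub_left, inner_sub_right,
    inner_neg_left, inner_smul_left, conj_trivial] at *
  simp only [real_inner_comm a yk, real_inner_comm a yk1, real_inner_comm a ys,
    real_inner_comm yk yk1, real_inner_comm yk ys, real_inner_comm yk1 ys] at *
  linarith
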